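/- arXiv:2103.11883 — 4 statements merged into one kernel-verified Lean document; each statement's English description precedes it below -/
import Mathlib

section
/- Let U be a finite nonempty set of joint actions, let Û ⊆ U be a nonempty subset whose complement U \ Û is also nonempty, let β ≥ 0, let R_max ≥ 0 and 0 ≤ γ < 1, and let Q : U → ℝ satisfy |Q(u)| ≤ R_max/(1−γ) for all u ∈ U. Suppose u* ∈ Û attains the maximum of Q over all of U, and let u' attain the maximum of Q over U \ Û. Then |sm_{β,Û}(Q) − sm_{β,U}(Q)| ≤ (2·R_max/(1−γ)) · |U \ Û| / (|U \ Û| + exp(β·(Q(u*) − Q(u')))), where |U \ Û| denotes the cardinality of U \ Û. -/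
open Real Finset

/-- The softmax operator over a finite set `A` of joint actions with inverse
temperature `β`. -/
noncomputable def sm {ι : Type*} (β : ℝ) (A : Finset ι) (Q : ι → ℝ) : ℝ :=
  (∑ u ∈ A, Real.exp (β * Q u) * Q u) / (∑ u ∈ A, Real.exp (β * Q u))

theorem softmax_denom_pos {ι : Type*} (β : ℝ) {A : Finset ι} (hA : A.Nonempty) (Q : ι → ℝ) :
    0 < ∑ u ∈ A, Real.exp (β * Q u) :=
  Finset.sum_pos (fun _ _ => Real.exp_pos _) hA

theorem abs_sm_le {ι : Type*} (β : ℝ) {A : Finset ι} (hA : A.Nonempty) (Q : ι → ℝ) {B : ℝ}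
    (hQ : ∀ u ∈ A, |Q u| ≤ B) : |sm β A Q| ≤ B := by
  have hpos := softmax_denom_pos β hA Q
  rw [sm, abs_div, abs_of_pos hpos, div_le_iff₀ hpos, Finset.mul_sum]
  refine (Finset.abs_sum_le_sum_abs _ _).trans (Finset.sum_le_sum fun u hu => ?_)
  rw [abs_mul, abs_of_pos (Real.exp_pos _), mul_comm]
  exact mul_le_mul_of_nonneg_right (hQ u hu) (Real.exp_pos _).le

/-- Enlarging the action set moves the softmax towards the softmax over the added actions, in
proportion to the weight they carry. -/
theorem sm_sub_sm_eq {ι : Type*} [DecidableEq ι] (β : ℝ) {A U : Finset ι} (hsub : A ⊆ U)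
    (hA : A.Nonempty) (hcomp : (U \ A).Nonempty) (Q : ι → ℝ) :
    sm β A Q - sm β U Q =
      (sm β A Q - sm β (U \ A) Q) *
        ((∑ u ∈ U \ A, Real.exp (β * Q u)) /
          ((∑ u ∈ U \ A, Real.exp (β * Q u)) + ∑ u ∈ A, Real.exp (β * Q u))) := by
  have hZ := softmax_denom_pos β hA Q
  have hW := softmax_denom_pos β hcomp Q
  simp only [sm]
  rw [← Finset.sum_sdiff hsub (f := fun u => Real.exp (β * Q u)),
    ← Finset.sum_sdiff hsub (f := fun u => Real.exp (β * Q u) * Q u)]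
  have hWZ := add_pos hW hZ
  field_simp
  ring

/-- The softmax weight of a set `C` of actions is bounded through its cardinality and the gap
between the best value on `C` and a value attained on `A`. -/
theorem softmax_weight_le {ι : Type*} {β : ℝ} (hβ : 0 ≤ β) {A C : Finset ι} (hC : C.Nonempty)
    (Q : ι → ℝ) {a : ι} (ha : a ∈ A) {c : ℝ} (hc : ∀ u ∈ C, Q u ≤ c) :
    (∑ u ∈ C, Real.exp (β * Q u)) /
        ((∑ u ∈ C, Real.exp (β * Q u)) + ∑ u ∈ A, Real.exp (β * Q u)) ≤
      C.card / (C.card + Real.exp (β * (Q a - c))) := by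
  have hW := softmax_denom_pos β hC Q
  have hZ := softmax_denom_pos β ⟨a, ha⟩ Q
  have hWle : ∑ u ∈ C, Real.exp (β * Q u) ≤ C.card * Real.exp (β * c) := by
    rw [← nsmul_eq_mul]
    exact Finset.sum_le_card_nsmul _ _ _ fun u hu =>
      Real.exp_le_exp.mpr (mul_le_mul_of_nonneg_left (hc u hu) hβ)
  have hZge : Real.exp (β * Q a) ≤ ∑ u ∈ A, Real.exp (β * Q u) :=
    Finset.single_le_sum (f := fun u => Real.exp (β * Q u)) (fun _ _ => (Real.exp_pos _).le) ha
  have hexp : Real.exp (β * c) * Real.exp (β * (Q a - c)) = Real.exp (β * Q a) := by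
    rw [← Real.exp_add]
    ring_nf
  have hcross : (∑ u ∈ C, Real.exp (β * Q u)) * Real.exp (β * (Q a - c)) ≤
      C.card * ∑ u ∈ A, Real.exp (β * Q u) :=
    calc _ ≤ C.card * Real.exp (β * c) * Real.exp (β * (Q a - c)) := by gcongr
      _ = C.card * Real.exp (β * Q a) := by rw [mul_assoc, hexp]
      _ ≤ _ := by gcongr
  rw [div_le_div_iff₀ (by positivity) (by positivity)]
  linarith

/-- Theorem 1 of the paper: the gap between the approximate softmax operator on
the subspace `Û` and the softmax operator on the whole joint action space `U`. -/
theorem approx_softmax_gap {ι : Type*} [DecidableEq ι]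
    (U Uhat : Finset ι) (hsub : Uhat ⊆ U) (hUhat : Uhat.Nonempty)
    (hcomp : (U \ Uhat).Nonempty)
    (β Rmax γ : ℝ) (hβ : 0 ≤ β) (hR : 0 ≤ Rmax) (hγ0 : 0 ≤ γ) (hγ1 : γ < 1)
    (Q : ι → ℝ) (hQ : ∀ u ∈ U, |Q u| ≤ Rmax / (1 - γ))
    (ustar : ι) (hustar : ustar ∈ Uhat) (hmax : ∀ u ∈ U, Q u ≤ Q ustar)
    (u' : ι) (hu' : u' ∈ U \ Uhat) (hmax' : ∀ u ∈ U \ Uhat, Q u ≤ Q u') :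
    |sm β Uhat Q - sm β U Q| ≤
      (2 * Rmax / (1 - γ)) *
        ((U \ Uhat).card /
          ((U \ Uhat).card + Real.exp (β * (Q ustar - Q u')))) := by
  rw [sm_sub_sm_eq β hsub hUhat hcomp Q, abs_mul]
  have hA := abs_sm_le β hUhat Q fun u hu => hQ u (hsub hu)
  have hC := abs_sm_le β hcomp Q fun u hu => hQ u (Finset.sdiff_subset hu)
  have hdiff : |sm β Uhat Q - sm β (U \ Uhat) Q| ≤ 2 * Rmax / (1 - γ) := by
    refine (abs_sub _ _).trans ((add_le_add hA hC).trans_eq ?_)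
    ring
  have hW := softmax_denom_pos β hcomp Q
  have hZ := softmax_denom_pos β hUhat Q
  rw [abs_of_pos (div_pos hW (add_pos hW hZ))]
  exact mul_le_mul hdiff (softmax_weight_le hβ hcomp Q hustar hmax')
    (div_pos hW (add_pos hW hZ)).le ((abs_nonneg _).trans hdiff)
end

section
/- Let A and B be disjoint finite nonempty subsets of a finite set of joint actions, let Q be a real-valued function on A ∪ B, and let β ≥ 0. Suppose u* ∈ A satisfies Q(u*) ≥ Q(u) for all u ∈ A ∪ B, and u' ∈ B satisfies Q(u') ≥ Q(u) for all u ∈ B. Writing S_A = ∑_{u∈A} exp(β·Q(u)) and S_B = ∑_{u∈B} exp(β·Q(u)), it holds that S_B/(S_A+S_B) ≤ |B| / (|B| + exp(β·(Q(u*) − Q(u')))), where |B| is the cardinality of B. -/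
open Real Finset

theorem softmax_weight_bound {ι : Type*} [DecidableEq ι]
    (A B : Finset ι) (hA : A.Nonempty) (hB : B.Nonempty)
    (hdisj : Disjoint A B) (Q : ι → ℝ) (β : ℝ) (hβ : 0 ≤ β)
    (ustar : ι) (hustar : ustar ∈ A) (hmaxstar : ∀ u ∈ A ∪ B, Q u ≤ Q ustar)
    (u' : ι) (hu' : u' ∈ B) (hmax' : ∀ u ∈ B, Q u ≤ Q u') :
    (∑ u ∈ B, Real.exp (β * Q u)) /
        ((∑ u ∈ A, Real.exp (β * Q u)) + (∑ u ∈ B, Real.exp (β * Q u))) ≤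
      (B.card : ℝ) / ((B.card : ℝ) + Real.exp (β * (Q ustar - Q u'))) := by
  have hSB : ∑ u ∈ B, Real.exp (β * Q u) ≤ B.card * Real.exp (β * Q u') := by
    rw [← nsmul_eq_mul]
    exact Finset.sum_le_card_nsmul _ _ _ fun u hu =>
      Real.exp_le_exp.2 (mul_le_mul_of_nonneg_left (hmax' u hu) hβ)
  have hSA : Real.exp (β * Q ustar) ≤ ∑ u ∈ A, Real.exp (β * Q u) :=
    Finset.single_le_sum (f := fun u => Real.exp (β * Q u))
      (fun u _ => (Real.exp_pos _).le) hustar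
  have hSB_pos : 0 < ∑ u ∈ B, Real.exp (β * Q u) :=
    Finset.sum_pos (fun u _ => Real.exp_pos _) hB
  have hexp : Real.exp (β * Q u') * Real.exp (β * (Q ustar - Q u')) =
      Real.exp (β * Q ustar) := by
    rw [← Real.exp_add]
    ring_nf
  have hcross : (∑ u ∈ B, Real.exp (β * Q u)) * Real.exp (β * (Q ustar - Q u')) ≤
      B.card * ∑ u ∈ A, Real.exp (β * Q u) :=
    calc
      _ ≤ B.card * Real.exp (β * Q u') * Real.exp (β * (Q ustar - Q u')) := by gcongr
      _ = B.card * Real.exp (β * Q ustar) := by rw [mul_assoc, hexp]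
      _ ≤ _ := by gcongr
  rw [div_le_div_iff₀ (add_pos ((Real.exp_pos _).trans_le hSA) hSB_pos) (by positivity)]
  linarith
end

section
/- Let U be a finite nonempty set of joint actions, Û ⊆ U a nonempty subset with U \ Û nonempty, R_max ≥ 0, 0 ≤ γ < 1, and Q : U → ℝ with |Q(u)| ≤ R_max/(1−γ) for all u. Suppose u* ∈ Û attains the maximum of Q over U, u' attains the maximum of Q over U \ Û, and Q(u*) > Q(u'). Then for every β ≥ 0, |sm_{β,Û}(Q) − sm_{β,U}(Q)| ≤ (2·R_max/(1−γ))·|U \ Û|·exp(−β·(Q(u*) − Q(u'))), and hence |sm_{β,Û}(Q) − sm_{β,U}(Q)| tends to 0 as β → ∞. -/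
open Real Finset Filter

theorem abs_sum_exp_mul_le {ι : Type*} (A : Finset ι) (Q : ι → ℝ) (β M : ℝ)
    (hQ : ∀ u ∈ A, |Q u| ≤ M) :
    |∑ u ∈ A, Real.exp (β * Q u) * Q u| ≤ M * ∑ u ∈ A, Real.exp (β * Q u) := by
  rw [Finset.mul_sum]
  refine (Finset.abs_sum_le_sum_abs _ _).trans (Finset.sum_le_sum fun u hu => ?_)
  rw [abs_mul, Real.abs_exp, mul_comm]
  exact mul_le_mul_of_nonneg_right (hQ u hu) (Real.exp_pos _).le

theorem abs_div_sub_add_div_add_le {N D n d M : ℝ} (hD : 0 < D) (hd : 0 ≤ d)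
    (hN : |N| ≤ M * D) (hn : |n| ≤ M * d) :
    |N / D - (N + n) / (D + d)| ≤ 2 * M * (d / D) := by
  have hM : 0 ≤ M := nonneg_of_mul_nonneg_left ((abs_nonneg N).trans hN) hD
  have hDd : 0 < D + d := by linarith
  have key : N / D - (N + n) / (D + d) = (N * d - n * D) / (D * (D + d)) := by
    field_simp
    ring
  have hnum : |N * d - n * D| ≤ 2 * M * d * D := by
    calc |N * d - n * D| ≤ |N * d| + |n * D| := abs_sub _ _
      _ = |N| * d + |n| * D := by rw [abs_mul, abs_mul, abs_of_nonneg hd, abs_of_pos hD]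
      _ ≤ M * D * d + M * d * D := by gcongr
      _ = 2 * M * d * D := by ring
  rw [key, abs_div, abs_of_pos (mul_pos hD hDd)]
  calc |N * d - n * D| / (D * (D + d)) ≤ 2 * M * d * D / (D * D) := by
        gcongr
        linarith
    _ = 2 * M * (d / D) := by field_simp

theorem sum_exp_div_sum_exp_le {ι : Type*} (A B : Finset ι) (Q : ι → ℝ) {β q : ℝ} (hβ : 0 ≤ β)
    {a : ι} (ha : a ∈ A) (hB : ∀ u ∈ B, Q u ≤ q) :
    (∑ u ∈ B, Real.exp (β * Q u)) / (∑ u ∈ A, Real.exp (β * Q u)) ≤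
      B.card * Real.exp (-β * (Q a - q)) := by
  have hA : Real.exp (β * Q a) ≤ ∑ u ∈ A, Real.exp (β * Q u) :=
    Finset.single_le_sum (f := fun u => Real.exp (β * Q u))
      (fun u _ => (Real.exp_pos _).le) ha
  have hsum : ∑ u ∈ B, Real.exp (β * Q u) ≤ B.card * Real.exp (β * q) := by
    rw [← nsmul_eq_mul]
    refine Finset.sum_le_card_nsmul _ _ _ fun u hu => ?_
    exact Real.exp_le_exp.mpr (mul_le_mul_of_nonneg_left (hB u hu) hβ)
  calc _ ≤ B.card * Real.exp (β * q) / Real.exp (β * Q a) := by gcongr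
    _ = B.card * Real.exp (-β * (Q a - q)) := by
        rw [mul_div_assoc, ← Real.exp_sub]
        ring_nf

theorem approx_softmax_gap_exp_decay {ι : Type*} [DecidableEq ι]
    (U Uhat : Finset ι) (hsub : Uhat ⊆ U) (hUhat : Uhat.Nonempty)
    (hcomp : (U \ Uhat).Nonempty)
    (Rmax γ : ℝ) (hR : 0 ≤ Rmax) (hγ0 : 0 ≤ γ) (hγ1 : γ < 1)
    (Q : ι → ℝ) (hQ : ∀ u ∈ U, |Q u| ≤ Rmax / (1 - γ))
    (ustar : ι) (hustar : ustar ∈ Uhat) (hmax : ∀ u ∈ U, Q u ≤ Q ustar)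
    (u' : ι) (hu' : u' ∈ U \ Uhat) (hmax' : ∀ u ∈ U \ Uhat, Q u ≤ Q u')
    (hgap : Q u' < Q ustar) :
    (∀ β : ℝ, 0 ≤ β →
        |sm β Uhat Q - sm β U Q| ≤
          (2 * Rmax / (1 - γ)) * (U \ Uhat).card *
            Real.exp (-β * (Q ustar - Q u'))) ∧
    Tendsto (fun β : ℝ => |sm β Uhat Q - sm β U Q|) atTop (nhds 0) := by
  have bound : ∀ β : ℝ, 0 ≤ β →
      |sm β Uhat Q - sm β U Q| ≤
        (2 * Rmax / (1 - γ)) * (U \ Uhat).card * Real.exp (-β * (Q ustar - Q u')) := by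
    intro β hβ
    have hM : 0 ≤ Rmax / (1 - γ) := div_nonneg hR (by linarith)
    have h := abs_div_sub_add_div_add_le
      (Finset.sum_pos (fun u _ => Real.exp_pos (β * Q u)) hUhat)
      (Finset.sum_nonneg fun u _ => (Real.exp_pos (β * Q u)).le)
      (abs_sum_exp_mul_le Uhat Q β _ fun u hu => hQ u (hsub hu))
      (abs_sum_exp_mul_le (U \ Uhat) Q β _ fun u hu => hQ u (Finset.sdiff_subset hu))
    rw [add_comm (∑ u ∈ Uhat, Real.exp (β * Q u) * Q u), Finset.sum_sdiff hsub,
      add_comm (∑ u ∈ Uhat, Real.exp (β * Q u)), Finset.sum_sdiff hsub] at h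
    refine h.trans ?_
    rw [mul_div_assoc, mul_assoc (2 * (Rmax / (1 - γ)))]
    exact mul_le_mul_of_nonneg_left (sum_exp_div_sum_exp_le _ _ Q hβ hustar hmax')
      (by positivity)
  refine ⟨bound, ?_⟩
  refine squeeze_zero' (Eventually.of_forall fun β => abs_nonneg _)
    ((eventually_ge_atTop 0).mono bound) ?_
  have hexp : Tendsto (fun β : ℝ => Real.exp (-β * (Q ustar - Q u'))) atTop (nhds 0) :=
    Real.tendsto_exp_atBot.comp
      (tendsto_neg_atTop_atBot.atBot_mul_const (sub_pos.mpr hgap))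
  simpa using hexp.const_mul ((2 * Rmax / (1 - γ)) * (U \ Uhat).card)
end

section
/- Let E be a real normed vector space, let f : E → ℝ be differentiable at a point θ ∈ E, and let T, R ∈ ℝ and λ ≥ 0 be constants. Define the regularized loss L₁(θ) = (T − f(θ))² + λ·(f(θ) − R)² and the target loss L₂(θ) = (y − f(θ))² with y = (T + λ·R)/(λ + 1). Then the Fréchet derivative of L₁ at θ equals (λ + 1) times the Fréchet derivative of L₂ at θ; consequently, a gradient step on L₁ with learning rate α coincides with a gradient step on L₂ with learning rate (λ + 1)·α. -/
open Real

/-- Theorem 2 of the paper (deterministic core): the gradient of the regularized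
loss `(T - f θ)² + λ (f θ - R)²` equals `(λ + 1)` times the gradient of the
target loss `(y - f θ)²` with `y = (T + λ R)/(λ + 1)`; hence a gradient step on
the former with learning rate `α` coincides with a gradient step on the latter
with learning rate `(λ + 1) α`. -/
theorem regularized_loss_gradient {E : Type*} [NormedAddCommGroup E] [NormedSpace ℝ E]
    (f : E → ℝ) (θ : E) (hf : DifferentiableAt ℝ f θ)
    (T R lam : ℝ) (hlam : 0 ≤ lam) :
    fderiv ℝ (fun x => (T - f x) ^ 2 + lam * (f x - R) ^ 2) θ =
      (lam + 1) • fderiv ℝ (fun x => ((T + lam * R) / (lam + 1) - f x) ^ 2) θ := by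
  have hlam' : lam + 1 ≠ 0 := by positivity
  have loss_eq : (fun x => (T - f x) ^ 2 + lam * (f x - R) ^ 2) = fun x =>
      (lam + 1) • ((T + lam * R) / (lam + 1) - f x) ^ 2 + lam * (T - R) ^ 2 / (lam + 1) := by
    funext x
    rw [smul_eq_mul]
    field_simp
    ring
  rw [loss_eq, fderiv_add_const]
  exact fderiv_const_smul ((hf.const_sub _).pow 2) (lam + 1)
end
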